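/- arXiv:2205.11943 — 2 statements merged into one kernel-verified Lean document; each statement's English description precedes it below -/
import Mathlib

section
/- The underlying D-topology of X_d equals the D-topology of X: a subset of X is open in the final topology for the plots of X_d if and only if it is open in the final topology for the plots of X, for any d > 0. -/
/-- A family of parametrizations of a set `X`: for each `n`, a predicate on pairs
`(U, p)` where `U ⊆ ℝⁿ` and `p : ℝⁿ → X` (thought of as defined on `U`). -/
def PlotFamily (X : Type u) :=
  ∀ n : ℕ, Set (Fin n → ℝ) → ((Fin n → ℝ) → X) → Prop

/-- `D` is a diffeology on `X`: domains of plots are open, all constant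
parametrizations are plots, being a plot only depends on the values on the domain,
plots satisfy locality, and plots are closed under precomposition with smooth maps
between Euclidean open sets. -/
structure IsDiffeology {X : Type u} (D : PlotFamily X) : Prop where
  isOpen : ∀ {n : ℕ} {U : Set (Fin n → ℝ)} {p : (Fin n → ℝ) → X}, D n U p → IsOpen U
  const : ∀ (n : ℕ) (U : Set (Fin n → ℝ)), IsOpen U → ∀ x : X, D n U (fun _ => x)
  congr : ∀ {n : ℕ} {U : Set (Fin n → ℝ)} {p q : (Fin n → ℝ) → X},
    D n U p → (∀ x ∈ U, q x = p x) → D n U q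
  locality : ∀ {n : ℕ} {U : Set (Fin n → ℝ)} {p : (Fin n → ℝ) → X}, IsOpen U →
    (∀ x ∈ U, ∃ W, IsOpen W ∧ x ∈ W ∧ W ⊆ U ∧ D n W p) → D n U p
  precomp : ∀ {n k : ℕ} {U : Set (Fin n → ℝ)} {V : Set (Fin k → ℝ)}
    {p : (Fin n → ℝ) → X} {F : (Fin k → ℝ) → (Fin n → ℝ)},
    D n U p → IsOpen V → ContDiffOn ℝ (⊤ : ℕ∞) F V → Set.MapsTo F V U → D k V (p ∘ F)

/-- A map between diffeological spaces is smooth if it sends plots to plots. -/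
def IsSmoothMap {X Y : Type*} (DX : PlotFamily X) (DY : PlotFamily Y) (f : X → Y) : Prop :=
  ∀ ⦃n : ℕ⦄ ⦃U : Set (Fin n → ℝ)⦄ ⦃p : (Fin n → ℝ) → X⦄, DX n U p → DY n U (f ∘ p)

/-- The `d`-coskeleton plot family: `p : U → X` is a plot iff `U` is open and the
precomposition of `p` with any smooth map from a Euclidean open set of dimension
`≤ d` into `U` is a plot of `X`. -/
def coskPlots {X : Type*} (D : PlotFamily X) (d : ℕ) : PlotFamily X :=
  fun n U p => IsOpen U ∧ ∀ (k : ℕ), k ≤ d →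
    ∀ (V : Set (Fin k → ℝ)) (F : (Fin k → ℝ) → (Fin n → ℝ)),
      IsOpen V → ContDiffOn ℝ (⊤ : ℕ∞) F V → Set.MapsTo F V U → D k V (p ∘ F)

/-- The `d`-skeleton plot family: the smallest diffeology on `X` containing all
plots of `X` of dimension `≤ d` (defined as the intersection of all diffeologies
containing those plots). -/
def skelPlots {X : Type*} (D : PlotFamily X) (d : ℕ) : PlotFamily X :=
  fun n U p => ∀ P : PlotFamily X, IsDiffeology P →
    (∀ (k : ℕ), k ≤ d → ∀ (V : Set (Fin k → ℝ)) (q : (Fin k → ℝ) → X), D k V q → P k V q) →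
    P n U p

/-- A set `A ⊆ X` is open in the D-topology of `(X, D)`: the final topology for
all plots, i.e. the preimage of `A` under any plot `p : U → X` is open in `U`. -/
def IsDOpen {X : Type u} (D : PlotFamily X) (A : Set X) : Prop :=
  ∀ (n : ℕ) (U : Set (Fin n → ℝ)) (p : (Fin n → ℝ) → X), D n U p → IsOpen (U ∩ p ⁻¹' A)

/-- A point of `S` at which `S` is not a neighbourhood is reached by a smooth curve
meeting the complement of `S` arbitrarily close to that point. -/
lemma exists_smooth_curve {E : Type*} [NormedAddCommGroup E] [NormedSpace ℝ E] [CompleteSpace E]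
    (S : Set E) (x : E) (hx : S ∉ nhds x) :
    ∃ c : ℝ → E, ContDiff ℝ (⊤ : ℕ∞) c ∧ c 0 = x ∧ ∀ k : ℕ, c ((1 / 2 : ℝ) ^ k) ∉ S := by
  have ht : ∀ k : ℕ, (0 : ℝ) < (1 / 2 : ℝ) ^ k := fun k => by positivity
  let φ : ∀ k : ℕ, ContDiffBump ((1 / 2 : ℝ) ^ k) := fun k =>
    ⟨(1 / 2 : ℝ) ^ k / 8, (1 / 2 : ℝ) ^ k / 4, by have := ht k; linarith,
      by have := ht k; linarith⟩
  have hsep : ∀ j k : ℕ, j ≠ k → φ j ((1 / 2 : ℝ) ^ k) = 0 := by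
    intro j k hjk
    apply (φ j).zero_of_le_dist
    change (1 / 2 : ℝ) ^ j / 4 ≤ |(1 / 2 : ℝ) ^ k - (1 / 2 : ℝ) ^ j|
    rcases lt_or_gt_of_ne hjk with h | h
    · have h1 : (1 / 2 : ℝ) ^ k ≤ (1 / 2 : ℝ) ^ (j + 1) :=
        pow_le_pow_of_le_one (by norm_num) (by norm_num) h
      rw [pow_succ] at h1
      have := ht j
      rw [abs_sub_comm]
      exact le_trans (by linarith) (le_abs_self _)
    · have h1 : (1 / 2 : ℝ) ^ j ≤ (1 / 2 : ℝ) ^ (k + 1) :=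
        pow_le_pow_of_le_one (by norm_num) (by norm_num) h
      rw [pow_succ] at h1
      have := ht j
      exact le_trans (by linarith) (le_abs_self _)
  have hone : ∀ k : ℕ, φ k ((1 / 2 : ℝ) ^ k) = 1 := fun k =>
    (φ k).one_of_mem_closedBall (Metric.mem_closedBall_self (φ k).rIn_pos.le)
  have hzero : ∀ k : ℕ, φ k 0 = 0 := by
    intro k
    apply (φ k).zero_of_le_dist
    change (1 / 2 : ℝ) ^ k / 4 ≤ |0 - (1 / 2 : ℝ) ^ k|
    have := ht k
    rw [abs_sub_comm]
    exact le_trans (by linarith) (le_abs_self _)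
  have hbd : ∀ k m : ℕ, ∃ C : ℝ, ∀ t : ℝ, ‖iteratedFDeriv ℝ m (φ k) t‖ ≤ C := by
    intro k m
    have h1 : HasCompactSupport (iteratedFDeriv ℝ m (φ k)) :=
      (φ k).hasCompactSupport.iteratedFDeriv m
    have h2 : Continuous (iteratedFDeriv ℝ m (φ k)) :=
      ((φ k).contDiff (n := (m : ℕ∞))).continuous_iteratedFDeriv le_rfl
    exact h1.exists_bound_of_continuous h2
  choose C hC using hbd
  have hC0 : ∀ k m, 0 ≤ C k m := fun k m => (norm_nonneg _).trans (hC k m 0)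
  let M : ℕ → ℝ := fun k => 1 + ∑ m ∈ Finset.range (k + 1), C k m
  have hM : ∀ k, 0 < M k := fun k => by
    have : 0 ≤ ∑ m ∈ Finset.range (k + 1), C k m := Finset.sum_nonneg fun m _ => hC0 k m
    change 0 < 1 + _
    linarith
  have hCM : ∀ k m, m ≤ k → C k m ≤ M k := fun k m hmk => by
    have : C k m ≤ ∑ m ∈ Finset.range (k + 1), C k m :=
      Finset.single_le_sum (f := C k) (fun m _ => hC0 k m) (Finset.mem_range.2 (by omega))
    change _ ≤ 1 + _
    linarith
  have hy : ∀ k : ℕ, ∃ y : E, y ∉ S ∧ ‖y - x‖ < (1 / 2 : ℝ) ^ k / M k := by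
    intro k
    by_contra! hcon
    apply hx
    refine Filter.mem_of_superset (Metric.ball_mem_nhds x (div_pos (ht k) (hM k))) ?_
    intro y hyb
    by_contra hyS
    rw [Metric.mem_ball, dist_eq_norm] at hyb
    exact absurd hyb (not_lt.2 (hcon y hyS))
  choose y hyS hyx using hy
  let f : ℕ → ℝ → E := fun k t => φ k t • (y k - x)
  have hfs : ∀ k, ContDiff ℝ (⊤ : ℕ∞) (f k) := fun k => (φ k).contDiff.smul contDiff_const
  have hsmooth : ContDiff ℝ (⊤ : ℕ∞) fun t => ∑' k, f k t := by
    refine contDiff_tsum_of_eventually (v := fun _ k => (1 / 2 : ℝ) ^ k) hfs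
      (fun _ _ => summable_geometric_of_lt_one (by norm_num) (by norm_num)) ?_
    intro m _
    rw [Nat.cofinite_eq_atTop]
    filter_upwards [Filter.eventually_ge_atTop m] with k hk t
    have h1 : ‖iteratedFDeriv ℝ m (f k) t‖ ≤
        ‖ContinuousLinearMap.toSpanSingleton ℝ (y k - x)‖ * ‖iteratedFDeriv ℝ m (φ k) t‖ :=
      (ContinuousLinearMap.toSpanSingleton ℝ (y k - x)).norm_iteratedFDeriv_comp_left
        ((φ k).contDiff (n := (m : ℕ∞))).contDiffAt le_rfl
    rw [ContinuousLinearMap.norm_toSpanSingleton] at h1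
    calc _ ≤ _ := h1
      _ ≤ ((1 / 2 : ℝ) ^ k / M k) * M k :=
        mul_le_mul (hyx k).le ((hC k m t).trans (hCM k m hk)) (norm_nonneg _)
          (div_pos (ht k) (hM k)).le
      _ = _ := div_mul_cancel₀ _ (hM k).ne'
  refine ⟨fun t => x + ∑' k, f k t, contDiff_const.add hsmooth, ?_, ?_⟩
  · simp [f, hzero]
  · intro k
    have : ∑' j, f j ((1 / 2 : ℝ) ^ k) = y k - x := by
      rw [tsum_eq_single k]
      · simp only [f, hone, one_smul]
      · intro j hj
        simp only [f, hsep j k hj, zero_smul]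
    simp only [this, add_sub_cancel]
    exact hyS k

/-- the D-topology of `X_d` equals the D-topology of `X` for `d > 0`. -/
theorem dTopology_skel_eq {X : Type u} (D : PlotFamily X) (hD : IsDiffeology D)
    (d : ℕ) (hd : 0 < d) (A : Set X) :
    IsDOpen (skelPlots D d) A ↔ IsDOpen D A := by
  constructor
  · intro h n U p hp
    rw [isOpen_iff_mem_nhds]
    intro x hx
    by_contra hnot
    obtain ⟨c, hc, hc0, hck⟩ := exists_smooth_curve _ x hnot
    let F : (Fin 1 → ℝ) → (Fin n → ℝ) := fun v => c (v 0)
    have hF : ContDiff ℝ (⊤ : ℕ∞) F := hc.comp (contDiff_apply ℝ ℝ (0 : Fin 1))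
    have hV : IsOpen (F ⁻¹' U) := (hD.isOpen hp).preimage hF.continuous
    have hq : D 1 (F ⁻¹' U) (p ∘ F) :=
      hD.precomp hp hV hF.contDiffOn (fun v hv => hv)
    have hO := h 1 _ _ (fun P _ hP => hP 1 hd _ _ hq)
    have hlim : Filter.Tendsto (fun k : ℕ => (fun _ : Fin 1 => (1 / 2 : ℝ) ^ k))
        Filter.atTop (nhds (fun _ : Fin 1 => (0 : ℝ))) :=
      tendsto_pi_nhds.2 fun _ =>
        tendsto_pow_atTop_nhds_zero_of_lt_one (by norm_num) (by norm_num)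
    have h0 : (fun _ : Fin 1 => (0 : ℝ)) ∈ F ⁻¹' U ∩ (p ∘ F) ⁻¹' A := by
      change c 0 ∈ U ∩ p ⁻¹' A
      rw [hc0]
      exact hx
    obtain ⟨k, hk⟩ := (hlim.eventually (hO.mem_nhds h0)).exists
    exact hck k hk
  · intro h n U p hp
    exact h n U p (hp D hD fun _ _ _ _ hq => hq)
end

section
/- The usual topology on an open subset U of ℝ^n coincides with the final topology for the smooth curves ℝ → U: a subset A ⊆ U is open in the subspace topology if and only if c⁻¹(A) is open in ℝ for every smooth map c : ℝ → U. -/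
set_option maxHeartbeats 2000000 in
/-- the usual topology on an open set `U ⊆ ℝⁿ` is final for the
smooth curves `ℝ → U`: a subset `A ⊆ U` is open iff `c ⁻¹' A` is open in `ℝ` for
every smooth curve `c : ℝ → ℝⁿ` with values in `U`. -/
theorem isOpen_iff_smooth_curve_preimages (n : ℕ) (U : Set (Fin n → ℝ)) (hU : IsOpen U)
    (A : Set (Fin n → ℝ)) (hA : A ⊆ U) :
    IsOpen A ↔
      ∀ c : ℝ → (Fin n → ℝ), ContDiff ℝ (⊤ : ℕ∞) c → Set.range c ⊆ U → IsOpen (c ⁻¹' A) := by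
  refine ⟨fun h c hc _ => h.preimage hc.continuous, fun H => ?_⟩
  rw [Metric.isOpen_iff]
  intro a ha
  by_contra hcon
  push Not at hcon
  obtain ⟨r, hr, hrU⟩ := Metric.isOpen_iff.1 hU a (hA ha)
  have hsum : Summable (fun k : ℕ => (1 : ℝ) ^ k / (k.factorial : ℝ)) :=
    Real.summable_pow_div_factorial 1
  set S : ℝ := ∑' k : ℕ, (1 : ℝ) ^ k / (k.factorial : ℝ) with hS
  have hS0 : 0 ≤ S := tsum_nonneg fun k => by positivity
  have hδ : 0 < r / (S + 1) := by positivity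
  set δ : ℝ := r / (S + 1) with hδdef
  have hδS : δ * S < r := by
    rw [hδdef, div_mul_eq_mul_div, div_lt_iff₀ (by positivity)]
    nlinarith
  have hex : ∀ k : ℕ, ∃ x : Fin n → ℝ, ‖x - a‖ ≤ δ / (k.factorial : ℝ) ∧ x ∉ A := by
    intro k
    have := hcon (δ / (k.factorial : ℝ)) (by positivity)
    obtain ⟨x, hx, hxA⟩ := Set.not_subset.1 this
    exact ⟨x, by rw [← dist_eq_norm]; exact (Metric.mem_ball.1 hx).le, hxA⟩
  choose x hx hxA using hex
  let φ : ContDiffBump (1 : ℝ) := ⟨1/4, 1/3, by norm_num, by norm_num⟩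
  have hφ1 : φ 1 = 1 := φ.one_of_mem_closedBall (by simp [φ])
  have hφ0 : ∀ t : ℝ, 1/3 ≤ |t - 1| → φ t = 0 := fun t ht =>
    φ.zero_of_le_dist (by simpa [Real.dist_eq, φ] using ht)
  have hφc : ContDiff ℝ (⊤ : ℕ∞) φ := φ.contDiff
  have hM : ∀ i : ℕ, ∃ M : ℝ, ∀ t, ‖iteratedFDeriv ℝ i φ t‖ ≤ M := fun i =>
    (φ.hasCompactSupport.iteratedFDeriv i).exists_bound_of_continuous
      (hφc.continuous_iteratedFDeriv (by exact_mod_cast le_top))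
  choose M hM using hM
  have hM0 : ∀ i, 0 ≤ M i := fun i => (norm_nonneg _).trans (hM i 0)
  let f : ℕ → ℝ → (Fin n → ℝ) := fun k t => φ ((2:ℝ)^k * t) • (x k - a)
  have hfc : ∀ k, ContDiff ℝ (⊤ : ℕ∞) (f k) := fun k =>
    (hφc.comp (contDiff_const.mul contDiff_id)).smul contDiff_const
  have hbound : ∀ (i k : ℕ) (t : ℝ),
      ‖iteratedFDeriv ℝ i (f k) t‖ ≤ (M i * δ) * (((2:ℝ)^i)^k / (k.factorial : ℝ)) := by
    intro i k t
    have hφi : ContDiff ℝ i φ := hφc.of_le (by exact_mod_cast le_top)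
    have hgi : ContDiff ℝ i (fun t : ℝ => φ ((2:ℝ)^k * t)) :=
      hφi.comp (contDiff_const.mul contDiff_id)
    rw [norm_iteratedFDeriv_eq_norm_iteratedDeriv]
    have e1 : iteratedDeriv i (f k) t
        = iteratedDeriv i (fun t : ℝ => φ ((2:ℝ)^k * t)) t • (x k - a) :=
      iteratedDeriv_smul_const hgi.contDiffAt _
    have e2 := congrFun (iteratedDeriv_comp_const_mul hφi ((2:ℝ)^k)) t
    have e3 : ‖iteratedDeriv i φ ((2:ℝ)^k * t)‖ ≤ M i := by
      rw [← norm_iteratedFDeriv_eq_norm_iteratedDeriv]; exact hM i _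
    rw [e1, e2, norm_smul, norm_mul, norm_pow, norm_pow]
    have e4 : ‖(2:ℝ)‖ = 2 := by norm_num
    rw [e4, ← pow_mul, mul_comm k i, pow_mul]
    calc ((2:ℝ)^i)^k * ‖iteratedDeriv i φ ((2:ℝ)^k * t)‖ * ‖x k - a‖
        ≤ ((2:ℝ)^i)^k * M i * (δ / (k.factorial : ℝ)) := by
          gcongr
          · exact mul_nonneg (by positivity) (hM0 i)
          · exact hx k
      _ = _ := by ring
  have hsm : ContDiff ℝ (⊤ : ℕ∞) (fun t => ∑' k, f k t) :=
    contDiff_tsum hfc (v := fun i k => (M i * δ) * (((2:ℝ)^i)^k / (k.factorial : ℝ)))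
      (fun i _ => (Real.summable_pow_div_factorial _).mul_left _) (fun i k t _ => hbound i k t)
  let c : ℝ → (Fin n → ℝ) := fun t => a + ∑' k, f k t
  have hcc : ContDiff ℝ (⊤ : ℕ∞) c := contDiff_const.add hsm
  have hrange : Set.range c ⊆ U := by
    rintro _ ⟨t, rfl⟩
    apply hrU
    rw [Metric.mem_ball, dist_eq_norm]
    have e : c t - a = ∑' k, f k t := by simp [c]
    rw [e]
    refine lt_of_le_of_lt (tsum_of_norm_bounded (hsum.hasSum.mul_left δ) fun k => ?_) hδS
    have h1 : ‖φ ((2:ℝ)^k * t)‖ ≤ 1 := by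
      rw [Real.norm_of_nonneg φ.nonneg]; exact φ.le_one
    calc ‖f k t‖ = ‖φ ((2:ℝ)^k * t)‖ * ‖x k - a‖ := norm_smul _ _
      _ ≤ 1 * (δ / (k.factorial : ℝ)) := by gcongr; exact hx k
      _ = _ := by rw [one_pow]; ring
  have hc0 : c 0 = a := by
    have : ∀ k, f k 0 = 0 := fun k => by
      have : φ ((2:ℝ)^k * 0) = 0 := hφ0 _ (by norm_num)
      simp only [f, this, zero_smul]
    simp [c, this]
  have hck : ∀ j : ℕ, c ((1/2:ℝ)^j) = x j := by
    intro j
    have h0 : ∀ k, k ≠ j → f k ((1/2:ℝ)^j) = 0 := by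
      intro k hk
      have : φ ((2:ℝ)^k * (1/2:ℝ)^j) = 0 := by
        apply hφ0
        rcases lt_or_gt_of_ne hk with h | h
        · obtain ⟨m, rfl⟩ := Nat.exists_eq_add_of_lt h
          have e : (2:ℝ)^k * (1/2:ℝ)^(k+m+1) = (1/2)^m * (1/2) := by
            rw [pow_succ, pow_add, ← mul_assoc, ← mul_assoc, ← mul_pow]; norm_num
          have h2 : (1/2:ℝ)^m ≤ 1 := pow_le_one₀ (by norm_num) (by norm_num)
          rw [e, abs_sub_comm]
          exact le_trans (by linarith) (le_abs_self _)
        · obtain ⟨m, rfl⟩ := Nat.exists_eq_add_of_lt h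
          have e : (2:ℝ)^(j+m+1) * (1/2:ℝ)^j = 2^m * 2 := by
            have : (2:ℝ)^j * (1/2:ℝ)^j = 1 := by rw [← mul_pow]; norm_num
            rw [pow_succ, pow_add]
            linear_combination (2^m * 2) * this
          have h2 : (1:ℝ) ≤ 2^m := one_le_pow₀ (by norm_num)
          rw [e]
          exact le_trans (by linarith) (le_abs_self _)
      simp only [f, this, zero_smul]
    have h1 : f j ((1/2:ℝ)^j) = x j - a := by
      have : (2:ℝ)^j * (1/2:ℝ)^j = 1 := by rw [← mul_pow]; norm_num
      simp only [f, this, hφ1, one_smul]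
    simp only [c]
    rw [tsum_eq_single j h0, h1]
    abel
  have hnhds : c ⁻¹' A ∈ nhds (0:ℝ) :=
    (H c hcc hrange).mem_nhds (by simpa [hc0] using ha)
  have ht : Filter.Tendsto (fun j : ℕ => (1/2:ℝ)^j) Filter.atTop (nhds 0) :=
    tendsto_pow_atTop_nhds_zero_of_lt_one (by norm_num) (by norm_num)
  obtain ⟨j, hj⟩ := (ht.eventually hnhds).exists
  exact hxA j (by rw [← hck j]; exact hj)
end
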